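/- Let V be a finite-dimensional vector space over ℚ with dim V = ρ, let B : V × V → ℚ be a symmetric bilinear form, let I be a finite index set with #I ≥ ρ² + ρ + 1, and let (y_i)_{i∈I} be a family of vectors in V such that B(y_i, y_i) < 0 for every i ∈ I and B(y_i, y_j) ≥ 0 whenever i ≠ j. Then there exist nonnegative integers (a_i)_{i∈I} such that the vector D = Σ_{i∈I} a_i · y_i satisfies B(D, D) > 0. -/

import Mathlib

/-- A family of non-isotropic vectors with pairwise nonpositive products, lying in a subspace `W`
on which the symmetric form `C` is positive semidefinite, has at most `2 * dim W` members. -/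
theorem card_le_two_mul_finrank_of_obtuse {K V I : Type*} [Field K] [LinearOrder K]
    [IsStrictOrderedRing K] [AddCommGroup V] [Module K V] [FiniteDimensional K V]
    (C : LinearMap.BilinForm K V) (hsymm : C.IsSymm) (W : Submodule K V)
    (hW : ∀ x ∈ W, 0 ≤ C x x) (s : Finset I) (y : I → V) (hy : ∀ i ∈ s, y i ∈ W)
    (hpos : ∀ i ∈ s, 0 < C (y i) (y i))
    (hobt : ∀ i ∈ s, ∀ j ∈ s, i ≠ j → C (y i) (y j) ≤ 0) :
    s.card ≤ 2 * Module.finrank K W := by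
  classical
  induction hn : Module.finrank K W using Nat.strong_induction_on generalizing W s y with
  | _ n ih =>
  rcases s.eq_empty_or_nonempty with rfl | ⟨v, hv⟩
  · simp
  have hvv := hpos v hv
  let p : I → V := fun i => y i - (C (y v) (y i) / C (y v) (y v)) • y v
  have hp : ∀ i j, C (p i) (p j) =
      C (y i) (y j) - C (y v) (y i) * C (y v) (y j) / C (y v) (y v) := by
    intro i j
    simp only [p, map_sub, map_smul, LinearMap.sub_apply, LinearMap.smul_apply, smul_eq_mul]
    have h : C (y i) (y v) = C (y v) (y i) := hsymm.eq (y i) (y v)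
    rw [h]
    field_simp
    ring
  have hpW : ∀ i ∈ s, p i ∈ W := fun i hi =>
    W.sub_mem (hy i hi) (W.smul_mem _ (hy v hv))
  let W' := W ⊓ LinearMap.ker (C (y v))
  have hlt : W' < W := by
    refine lt_of_le_of_ne inf_le_left fun h => ?_
    have : y v ∈ W' := h ▸ hy v hv
    exact hvv.ne' this.2
  have hrank : Module.finrank K W' < n := hn ▸ Submodule.finrank_lt_finrank_of_lt hlt
  have hprod : ∀ i ∈ s.erase v, ∀ j ∈ s.erase v,
      0 ≤ C (y v) (y i) * C (y v) (y j) := by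
    intro i hi j hj
    rw [Finset.mem_erase] at hi hj
    exact mul_nonneg_of_nonpos_of_nonpos (hobt v hv i hi.2 hi.1.symm)
      (hobt v hv j hj.2 hj.1.symm)
  have hfar := ih _ hrank W' (fun x hx => hW x hx.1)
    ((s.erase v).filter fun i => 0 < C (p i) (p i)) p
    (fun i hi => ⟨hpW i (Finset.mem_of_mem_erase (Finset.mem_filter.1 hi).1), by
      simp [p, hvv.ne']⟩)
    (fun i hi => (Finset.mem_filter.1 hi).2)
    (fun i hi j hj hij => by
      have hi' := (Finset.mem_filter.1 hi).1
      have hj' := (Finset.mem_filter.1 hj).1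
      have h₁ := hobt i (Finset.mem_of_mem_erase hi') j (Finset.mem_of_mem_erase hj') hij
      have h₂ := div_nonneg (hprod i hi' j hj') hvv.le
      rw [hp]
      linarith) rfl
  have hnear : ((s.erase v).filter fun i => ¬ 0 < C (p i) (p i)).card ≤ 1 := by
    refine Finset.card_le_one.2 fun i hi j hj => ?_
    by_contra hij
    obtain ⟨hi', hi₀⟩ := Finset.mem_filter.1 hi
    obtain ⟨hj', hj₀⟩ := Finset.mem_filter.1 hj
    have his := Finset.mem_of_mem_erase hi'
    have hjs := Finset.mem_of_mem_erase hj'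
    have hne : ∀ k ∈ s, ¬ 0 < C (p k) (p k) → C (y v) (y k) ≠ 0 := by
      intro k hk hk₀ h
      apply hk₀
      rw [hp, h]
      simpa using hpos k hk
    have h₁ : 0 < C (y v) (y i) * C (y v) (y j) / C (y v) (y v) :=
      div_pos (lt_of_le_of_ne (hprod i hi' j hj')
        (mul_ne_zero (hne i his hi₀) (hne j hjs hj₀)).symm) hvv
    have h₂ := hobt i his j hjs hij
    have h₃ := hW _ (W.add_mem (hpW i his) (hpW j hjs))
    have h₄ : C (p j) (p i) = C (p i) (p j) := hsymm.eq (p j) (p i)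
    simp only [map_add, LinearMap.add_apply, h₄] at h₃
    have h₅ := hp i j
    linarith
  have hcard := Finset.card_filter_add_card_filter_not (s := s.erase v)
    (fun i => 0 < C (p i) (p i))
  have := Finset.card_erase_add_one hv
  omega

/-- Finitely many nonnegative rationals have a common positive natural multiplier making them
natural numbers. -/
theorem exists_nat_mul_eq_natCast {I : Type*} [Fintype I] (c : I → ℚ) (hc : ∀ i, 0 ≤ c i) :
    ∃ N : ℕ, 0 < N ∧ ∃ a : I → ℕ, ∀ i, (a i : ℚ) = N * c i := by
  refine ⟨∏ j, (c j).den, Finset.prod_pos fun j _ => (c j).den_pos, ?_⟩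
  have h : ∀ i, ∃ k : ℕ, (k : ℚ) = ((∏ j, (c j).den : ℕ) : ℚ) * c i := by
    intro i
    obtain ⟨m, hm⟩ := Finset.dvd_prod_of_mem (fun j => (c j).den) (Finset.mem_univ i)
    refine ⟨m * (c i).num.toNat, ?_⟩
    have h₁ : (((c i).num.toNat : ℤ) : ℚ) = (c i).num := by
      rw [Int.toNat_of_nonneg (Rat.num_nonneg.2 (hc i))]
    have h₂ := Rat.mul_den_eq_num (c i)
    rw [hm]
    push_cast at h₁ ⊢
    rw [h₁, ← h₂]
    ring
  choose a ha using h
  exact ⟨a, ha⟩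

/-- If the products of distinct vectors are nonnegative, then replacing coefficients by their
absolute values does not decrease the quadratic form. -/
theorem bilinForm_sum_le_sum_abs {K V I : Type*} [Field K] [LinearOrder K]
    [IsStrictOrderedRing K] [AddCommGroup V] [Module K V] [Fintype I]
    (B : LinearMap.BilinForm K V) (y : I → V)
    (hnn : ∀ i j, i ≠ j → 0 ≤ B (y i) (y j)) (c : I → K) :
    B (∑ i, c i • y i) (∑ i, c i • y i) ≤ B (∑ i, |c i| • y i) (∑ i, |c i| • y i) := by
  simp only [map_sum, LinearMap.sum_apply, map_smul, LinearMap.smul_apply, smul_eq_mul,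
    Finset.mul_sum, ← mul_assoc]
  refine Finset.sum_le_sum fun i _ => Finset.sum_le_sum fun j _ => ?_
  by_cases hij : j = i
  · subst hij
    rw [abs_mul_abs_self]
  · rw [← abs_mul]
    exact mul_le_mul_of_nonneg_right (le_abs_self _) (hnn _ _ hij)

/-- Lemma 4.1 (linear-algebraic content): in a `ρ`-dimensional `ℚ`-vector space,
given a symmetric bilinear form `B` and a family `(y i)` indexed by a finite set `I`
with `#I ≥ ρ² + ρ + 1`, such that `B (y i) (y i) < 0` for all `i` and
`B (y i) (y j) ≥ 0` for `i ≠ j`, there are nonnegative integers `a i` with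
`B D D > 0` for `D = ∑ a i • y i`. -/
theorem stmt_0 {V : Type*} [AddCommGroup V] [Module ℚ V] [FiniteDimensional ℚ V]
    (ρ : ℕ) (hdim : Module.finrank ℚ V = ρ)
    (B : LinearMap.BilinForm ℚ V) (hsymm : B.IsSymm)
    {I : Type*} [Fintype I] (hI : ρ ^ 2 + ρ + 1 ≤ Fintype.card I)
    (y : I → V)
    (hneg : ∀ i, B (y i) (y i) < 0)
    (hnn : ∀ i j, i ≠ j → 0 ≤ B (y i) (y j)) :
    ∃ a : I → ℕ,
      0 < B (∑ i, (a i : ℚ) • y i) (∑ i, (a i : ℚ) • y i) := by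
  by_contra! hcon
  have hnonpos : ∀ c : I → ℚ, B (∑ i, c i • y i) (∑ i, c i • y i) ≤ 0 := by
    intro c
    refine (bilinForm_sum_le_sum_abs B y hnn c).trans ?_
    obtain ⟨N, hN, a, ha⟩ := exists_nat_mul_eq_natCast (fun i => |c i|) fun i => abs_nonneg _
    have h := hcon a
    simp only [ha, mul_smul, ← Finset.smul_sum, map_smul, LinearMap.smul_apply,
      smul_eq_mul] at h
    have hN' : (0 : ℚ) < N := by exact_mod_cast hN
    exact nonpos_of_mul_nonpos_right (nonpos_of_mul_nonpos_right h hN') hN'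
  have hcard := card_le_two_mul_finrank_of_obtuse (-B)
    ⟨fun x z => by simpa using hsymm.eq x z⟩ (Submodule.span ℚ (Set.range y))
    (fun x hx => by
      obtain ⟨c, rfl⟩ := (Submodule.mem_span_range_iff_exists_fun ℚ).1 hx
      simpa using hnonpos c)
    Finset.univ y (fun i _ => Submodule.subset_span ⟨i, rfl⟩)
    (fun i _ => by simpa using hneg i) (fun i _ j _ hij => by simpa using hnn i j hij)
  have hrank := (Submodule.span ℚ (Set.range y)).finrank_le
  rw [Finset.card_univ] at hcard
  nlinarith [Nat.le_self_pow two_ne_zero ρ]
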